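/- arXiv:1804.04455 — 6 statements merged into one kernel-verified Lean document; each statement's English description precedes it below -/
import Mathlib

section
/- Let S be a profinite space. The principal ideal ϖO_K = {x ∈ O_K : ‖x‖ ≤ ‖ϖ‖} is open in O_K, so for every continuous f : S → O_K the reduction s ↦ f(s) mod ϖO_K is a locally constant function S → O_K/ϖO_K. The resulting ring homomorphism Φ : C(S, O_K) → LocallyConstant(S, O_K/ϖO_K) is surjective, and its kernel is the principal ideal ϖ·C(S, O_K); hence C(S,O_K)/ϖ·C(S,O_K) ≅ LocallyConstant(S, O_K/ϖO_K) as rings. -/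
/-- The ring of integers `O_K = {x : ‖x‖ ≤ 1}` of a nonarchimedean normed field. -/
def integerRing (K : Type*) [NormedField K] [IsUltrametricDist K] : Subring K where
  carrier := {x : K | ‖x‖ ≤ 1}
  one_mem' := by simp
  zero_mem' := by simp
  mul_mem' {a b} ha hb := by
    simp only [Set.mem_setOf_eq, norm_mul] at *
    exact mul_le_one₀ ha (norm_nonneg b) hb
  add_mem' {a b} ha hb :=
    le_trans (IsUltrametricDist.norm_add_le_max a b) (max_le ha hb)
  neg_mem' {a} ha := by simpa using ha

namespace integerRing

variable {K : Type*} [NormedField K] [IsUltrametricDist K] {ϖ : integerRing K}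

theorem mem_span_singleton_iff (hϖ : 0 < ‖(ϖ : K)‖) {x : integerRing K} :
    x ∈ Ideal.span {ϖ} ↔ ‖(x : K)‖ ≤ ‖(ϖ : K)‖ := by
  rw [Ideal.mem_span_singleton]
  constructor
  · rintro ⟨y, rfl⟩
    have hy : ‖(y : K)‖ ≤ 1 := y.2
    simpa using mul_le_of_le_one_right (norm_nonneg (ϖ : K)) hy
  · intro hx
    have hy : ‖(x : K) / ϖ‖ ≤ 1 := by
      rw [norm_div]
      exact div_le_one_of_le₀ hx hϖ.le
    exact ⟨⟨x / ϖ, hy⟩, Subtype.ext (mul_div_cancel₀ _ (norm_pos_iff.mp hϖ)).symm⟩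

theorem isOpen_span_singleton (hϖ : 0 < ‖(ϖ : K)‖) :
    IsOpen ((Ideal.span {ϖ} : Ideal (integerRing K)) : Set (integerRing K)) := by
  have h : ((Ideal.span {ϖ} : Ideal (integerRing K)) : Set (integerRing K)) =
      Subtype.val ⁻¹' Metric.closedBall (0 : K) ‖(ϖ : K)‖ := by
    ext x
    simp [mem_span_singleton_iff hϖ]
  rw [h]
  exact (IsUltrametricDist.isOpen_closedBall 0 hϖ.ne').preimage continuous_subtype_val

theorem forall_mem_span_singleton_iff {S : Type*} [TopologicalSpace S] (hϖ : 0 < ‖(ϖ : K)‖)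
    (f : C(S, integerRing K)) :
    (∀ s, f s ∈ Ideal.span {ϖ}) ↔
      ∃ h : C(S, integerRing K), f = ContinuousMap.const S ϖ * h := by
  constructor
  · intro hf
    have hle (s : S) : ‖(f s : K) / ϖ‖ ≤ 1 := by
      rw [norm_div]
      exact div_le_one_of_le₀ ((mem_span_singleton_iff hϖ).mp (hf s)) hϖ.le
    refine ⟨⟨fun s => ⟨f s / ϖ, hle s⟩, ?_⟩, ?_⟩
    · exact ((continuous_subtype_val.comp f.continuous).div_const _).subtype_mk hle
    · ext s
      exact (mul_div_cancel₀ _ (norm_pos_iff.mp hϖ)).symm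
  · rintro ⟨h, rfl⟩ s
    exact Ideal.mul_mem_right _ _ (Ideal.mem_span_singleton_self ϖ)

end integerRing

namespace ContinuousMap

variable {S R : Type*} [TopologicalSpace S] [CommRing R] [TopologicalSpace R]
  {I : Ideal R}

theorem exists_mk_eq_locallyConstant (g : LocallyConstant S (R ⧸ I)) :
    ∃ f : C(S, R), ∀ s, Ideal.Quotient.mk I (f s) = g s :=
  ⟨(g.map Quotient.out : LocallyConstant S R), fun s => Ideal.Quotient.mk_out (g s)⟩

variable [IsTopologicalRing R]

theorem isLocallyConstant_mk_of_isOpen (hI : IsOpen (I : Set R)) (f : C(S, R)) :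
    IsLocallyConstant fun s => Ideal.Quotient.mk I (f s) := by
  refine (IsLocallyConstant.iff_exists_open _).mpr fun s =>
    ⟨{t | f t - f s ∈ I}, hI.preimage (f.continuous.sub continuous_const), by simp,
      fun t ht => Ideal.Quotient.eq.mpr ht⟩

/-- Pointwise reduction of continuous functions modulo an open ideal. -/
def reduceModOpenIdeal (S : Type*) [TopologicalSpace S] (hI : IsOpen (I : Set R)) :
    C(S, R) →+* LocallyConstant S (R ⧸ I) where
  toFun f := ⟨fun s => Ideal.Quotient.mk I (f s), isLocallyConstant_mk_of_isOpen hI f⟩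
  map_one' := rfl
  map_zero' := rfl
  map_add' _ _ := rfl
  map_mul' _ _ := rfl

end ContinuousMap

/-- Let `K` be a field complete with respect to a nontrivial multiplicative
nonarchimedean absolute value, with ring of integers `O_K` and pseudo-uniformizer `ϖ`, and let
`S` be a profinite space. The principal ideal `ϖO_K` equals `{x ∈ O_K : ‖x‖ ≤ ‖ϖ‖}` and is open
in `O_K`, so for every continuous `f : S → O_K` the reduction `s ↦ f s mod ϖO_K` is locally
constant. The resulting ring homomorphism `Φ : C(S, O_K) → LocallyConstant S (O_K/ϖO_K)` is
surjective and its kernel is the principal ideal `ϖ·C(S, O_K)`; hence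
`C(S, O_K)/ϖ·C(S, O_K) ≅ LocallyConstant S (O_K/ϖO_K)` as rings. -/
theorem continuousMap_integers_mod_pseudouniformizer
    {K : Type*} [NormedField K] [CompleteSpace K] [IsUltrametricDist K]
    {S : Type*} [TopologicalSpace S] [CompactSpace S] [T2Space S] [TotallyDisconnectedSpace S]
    (ϖ : integerRing K) (hϖ0 : 0 < ‖(ϖ : K)‖) (hϖ1 : ‖(ϖ : K)‖ < 1) :
    (((Ideal.span {ϖ} : Ideal (integerRing K)) : Set (integerRing K)) =
      {x : integerRing K | ‖(x : K)‖ ≤ ‖(ϖ : K)‖}) ∧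
    IsOpen (((Ideal.span {ϖ} : Ideal (integerRing K)) : Set (integerRing K))) ∧
    (∀ f : C(S, integerRing K),
      IsLocallyConstant fun s : S => Ideal.Quotient.mk (Ideal.span {ϖ}) (f s)) ∧
    (∀ g : LocallyConstant S ((integerRing K) ⧸ (Ideal.span {ϖ} : Ideal (integerRing K))),
      ∃ f : C(S, integerRing K), ∀ s : S, Ideal.Quotient.mk (Ideal.span {ϖ}) (f s) = g s) ∧
    (∀ f : C(S, integerRing K),
      (∀ s : S, Ideal.Quotient.mk (Ideal.span {ϖ}) (f s) = 0) ↔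
        ∃ h : C(S, integerRing K), f = ContinuousMap.const S ϖ * h) ∧
    Nonempty
      ((C(S, integerRing K) ⧸
          (Ideal.span {ContinuousMap.const S ϖ} : Ideal C(S, integerRing K))) ≃+*
        LocallyConstant S ((integerRing K) ⧸ (Ideal.span {ϖ} : Ideal (integerRing K)))) := by
  have hopen := integerRing.isOpen_span_singleton hϖ0
  have hker (f : C(S, integerRing K)) :
      (∀ s : S, Ideal.Quotient.mk (Ideal.span {ϖ}) (f s) = 0) ↔
        ∃ h : C(S, integerRing K), f = ContinuousMap.const S ϖ * h := by
    simpa only [Ideal.Quotient.eq_zero_iff_mem] using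
      integerRing.forall_mem_span_singleton_iff hϖ0 f
  refine ⟨Set.ext fun x => integerRing.mem_span_singleton_iff hϖ0, hopen,
    ContinuousMap.isLocallyConstant_mk_of_isOpen hopen,
    ContinuousMap.exists_mk_eq_locallyConstant, hker, ?_⟩
  have hsurj : Function.Surjective (ContinuousMap.reduceModOpenIdeal S hopen) := fun g =>
    (ContinuousMap.exists_mk_eq_locallyConstant g).imp fun _ hf => LocallyConstant.ext hf
  have hspan : Ideal.span {ContinuousMap.const S ϖ} =
      RingHom.ker (ContinuousMap.reduceModOpenIdeal S hopen) := by
    ext f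
    rw [Ideal.mem_span_singleton, RingHom.mem_ker, LocallyConstant.ext_iff]
    exact (hker f).symm
  exact ⟨(Ideal.quotEquivOfEq hspan).trans (RingHom.quotientKerEquivOfSurjective hsurj)⟩
end

section
/- Let S be a compact topological space. Then the ring C(S, O_K) of continuous O_K-valued functions on S is ϖ-adically separated and complete, i.e. C(S, O_K) is adically complete with respect to the principal ideal generated by the constant function with value ϖ. -/
instance integerRing.completeSpace (K : Type*) [NormedField K] [CompleteSpace K]
    [IsUltrametricDist K] : CompleteSpace (integerRing K) :=
  (isClosed_le continuous_norm continuous_const :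
    IsClosed {x : K | ‖x‖ ≤ 1}).completeSpace_coe

/-- A continuous `O_K`-valued function is divisible by `ϖ ^ n` if and only if it is bounded in
norm by `‖ϖ‖ ^ n`. -/
theorem integerRing.mem_span_const_pow_smul_top_iff {K : Type*} [NormedField K]
    [IsUltrametricDist K] {S : Type*} [TopologicalSpace S] {ϖ : integerRing K}
    (hϖ0 : 0 < ‖(ϖ : K)‖) (n : ℕ) (g : C(S, integerRing K)) :
    g ∈ ((Ideal.span {ContinuousMap.const S ϖ}) ^ n • ⊤ : Submodule C(S, integerRing K)
      C(S, integerRing K)) ↔ ∀ s, ‖(g s : K)‖ ≤ ‖(ϖ : K)‖ ^ n := by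
  rw [smul_eq_mul, Ideal.mul_top, Ideal.span_singleton_pow, Ideal.mem_span_singleton]
  constructor
  · rintro ⟨h, rfl⟩ s
    have hs : ‖(h s : K)‖ ≤ 1 := (h s).2
    simpa using mul_le_of_le_one_right (by positivity : 0 ≤ ‖(ϖ : K)‖ ^ n) hs
  · intro hg
    have hpos : 0 < ‖(ϖ : K)‖ ^ n := by positivity
    have hne : (ϖ : K) ^ n ≠ 0 := pow_ne_zero n (norm_pos_iff.mp hϖ0)
    refine ⟨⟨fun s ↦ ⟨(g s : K) / (ϖ : K) ^ n, ?_⟩, ?_⟩, ?_⟩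
    · change ‖(g s : K) / (ϖ : K) ^ n‖ ≤ 1
      rw [norm_div, norm_pow]
      exact (div_le_one hpos).mpr (hg s)
    · exact ((continuous_subtype_val.comp g.continuous).div_const _).subtype_mk _
    · ext s
      simp [mul_div_cancel₀ _ hne]

/-- Let `K` be a field complete with respect to a nontrivial multiplicative
nonarchimedean absolute value, with ring of integers `O_K` and pseudo-uniformizer `ϖ`
(`0 < ‖ϖ‖ < 1`). For a compact topological space `S`, the ring `C(S, O_K)` of continuous
`O_K`-valued functions is `ϖ`-adically separated and complete, i.e. it is adically complete
with respect to the principal ideal generated by the constant function with value `ϖ`. -/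
theorem continuousMap_integers_adicComplete
    {K : Type*} [NormedField K] [CompleteSpace K] [IsUltrametricDist K]
    {S : Type*} [TopologicalSpace S] [CompactSpace S]
    (ϖ : integerRing K) (hϖ0 : 0 < ‖(ϖ : K)‖) (hϖ1 : ‖(ϖ : K)‖ < 1) :
    IsAdicComplete (Ideal.span {ContinuousMap.const S ϖ}) C(S, integerRing K) := by
  have smodEq_iff (n : ℕ) (f g : C(S, integerRing K)) :
      f ≡ g [SMOD ((Ideal.span {ContinuousMap.const S ϖ}) ^ n • ⊤ :
        Submodule C(S, integerRing K) C(S, integerRing K))] ↔ dist f g ≤ ‖(ϖ : K)‖ ^ n := by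
    rw [SModEq.sub_mem, integerRing.mem_span_const_pow_smul_top_iff hϖ0,
      ContinuousMap.dist_le (by positivity)]
    simp [dist_eq_norm]
  refine { haus' := fun f hf ↦ ?_, prec' := fun f hf ↦ ?_ }
  · exact dist_le_zero.mp (ge_of_tendsto' (tendsto_pow_atTop_nhds_zero_of_lt_one
      (norm_nonneg _) hϖ1) fun n ↦ (smodEq_iff n f 0).mp (hf n))
  · have hdist {m n : ℕ} (hmn : m ≤ n) : dist (f m) (f n) ≤ ‖(ϖ : K)‖ ^ m :=
      (smodEq_iff m _ _).mp (hf hmn)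
    obtain ⟨L, hL⟩ := cauchySeq_tendsto_of_complete
      (cauchySeq_of_le_geometric ‖(ϖ : K)‖ 1 hϖ1 fun n ↦ by simpa using hdist n.le_succ)
    refine ⟨L, fun n ↦ (smodEq_iff n _ _).mpr ?_⟩
    exact le_of_tendsto (tendsto_const_nhds.dist hL)
      ((Filter.eventually_ge_atTop n).mono fun m hm ↦ hdist hm)
end

section
/- Let f : E → A be a surjective homomorphism of abelian groups with kernel M, and let L be a subgroup of E containing M such that multiplication by p^n is injective on L and maps L onto M (i.e. p^n·L = M). Then f(L) and f(E[p^n]) are subgroups of the p^n-torsion subgroup A[p^n], their intersection is trivial, and their sum is all of A[p^n]; that is, A[p^n] is the internal direct sum f(L) ⊕ f(E[p^n]). -/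
/-- The `k`-torsion subgroup `{g : k • g = 0}` of an abelian group. -/
def nTorsion (k : ℕ) (G : Type*) [AddCommGroup G] : AddSubgroup G where
  carrier := {g : G | k • g = 0}
  zero_mem' := smul_zero k
  add_mem' {a b} ha hb := by
    simp only [Set.mem_setOf_eq] at *
    rw [smul_add, ha, hb, add_zero]
  neg_mem' {a} ha := by
    simp only [Set.mem_setOf_eq] at *
    rw [smul_neg, ha, neg_zero]

/-- Let `f : E → A` be a surjective homomorphism of abelian groups with kernel
`M`, and let `L` be a subgroup of `E` containing `M` such that multiplication by `pⁿ` is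
injective on `L` and maps `L` onto `M`. Then `f(L)` and `f(E[pⁿ])` are subgroups of `A[pⁿ]`,
their intersection is trivial and their sum is all of `A[pⁿ]`; that is, `A[pⁿ]` is the internal
direct sum `f(L) ⊕ f(E[pⁿ])`. -/
theorem torsion_internal_direct_sum
    {E A : Type*} [AddCommGroup E] [AddCommGroup A]
    (p n : ℕ) (hp : p.Prime) (hn : 0 < n)
    (f : E →+ A) (hf : Function.Surjective f)
    (M : AddSubgroup E) (hM : M = f.ker)
    (L : AddSubgroup E) (hML : M ≤ L)
    (hinj : ∀ x ∈ L, ∀ y ∈ L, p ^ n • x = p ^ n • y → x = y)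
    (himg : (fun x : E => p ^ n • x) '' (L : Set E) = (M : Set E)) :
    L.map f ≤ nTorsion (p ^ n) A ∧
    (nTorsion (p ^ n) E).map f ≤ nTorsion (p ^ n) A ∧
    L.map f ⊓ (nTorsion (p ^ n) E).map f = ⊥ ∧
    L.map f ⊔ (nTorsion (p ^ n) E).map f = nTorsion (p ^ n) A := by
  have map_L_le : L.map f ≤ nTorsion (p ^ n) A := by
    rintro _ ⟨l, hl, rfl⟩
    have hmem : p ^ n • l ∈ (M : Set E) := himg ▸ Set.mem_image_of_mem _ hl
    rw [SetLike.mem_coe, hM, AddMonoidHom.mem_ker] at hmem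
    change p ^ n • f l = 0
    rw [← map_nsmul, hmem]
  have map_torsion_le : (nTorsion (p ^ n) E).map f ≤ nTorsion (p ^ n) A := by
    rintro _ ⟨t, ht, rfl⟩
    have ht : p ^ n • t = 0 := ht
    change p ^ n • f t = 0
    rw [← map_nsmul, ht, map_zero]
  refine ⟨map_L_le, map_torsion_le, ?_, le_antisymm (sup_le map_L_le map_torsion_le) ?_⟩
  · rw [eq_bot_iff]
    rintro _ ⟨⟨l, hl, rfl⟩, ⟨t, ht, htl⟩⟩
    have ht : p ^ n • t = 0 := ht
    have hdiff : t - l ∈ M := by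
      rw [hM, AddMonoidHom.mem_ker, map_sub, htl, sub_self]
    have htL : t ∈ L := by simpa using L.add_mem (hML hdiff) hl
    have ht0 : t = 0 := hinj t htL 0 L.zero_mem (by rw [ht, smul_zero])
    rw [AddSubgroup.mem_bot, ← htl, ht0, map_zero]
  · intro a ha
    obtain ⟨e, rfl⟩ := hf a
    have ha : p ^ n • f e = 0 := ha
    have hmem : p ^ n • e ∈ (M : Set E) := by
      rw [SetLike.mem_coe, hM, AddMonoidHom.mem_ker, map_nsmul, ha]
    rw [← himg] at hmem
    obtain ⟨l, hl, hle⟩ := hmem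
    have hle : p ^ n • l = p ^ n • e := hle
    have htors : p ^ n • (e - l) = 0 := by rw [smul_sub, hle, sub_self]
    exact AddSubgroup.mem_sup.mpr
      ⟨f l, ⟨l, hl, rfl⟩, f (e - l), ⟨e - l, htors, rfl⟩, by rw [← map_add, add_sub_cancel]⟩
end

section
/- Let E be an abelian group, M a subgroup of E, and L a subgroup of E such that multiplication by p^n is injective on L and maps L onto M (i.e. p^n·L = M). Let U ⊆ E be a subset on which the quotient map E → E/M is injective. Then the quotient map E → E/L is injective on the set {e ∈ E : p^n·e ∈ U}. -/
/-- Let `E` be an abelian group, `M` a subgroup of `E` and `L` a subgroup of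
`E` such that multiplication by `pⁿ` is injective on `L` and maps `L` onto `M`. Let `U ⊆ E` be
a subset on which the quotient map `E → E/M` is injective. Then the quotient map `E → E/L` is
injective on the set `{e : pⁿ•e ∈ U}`. -/
theorem quotient_map_injective_on_pn_preimage
    {E : Type*} [AddCommGroup E]
    (p n : ℕ) (hp : p.Prime) (hn : 0 < n)
    (M L : AddSubgroup E)
    (hinj : ∀ x ∈ L, ∀ y ∈ L, p ^ n • x = p ^ n • y → x = y)
    (himg : (fun x : E => p ^ n • x) '' (L : Set E) = (M : Set E))
    (U : Set E)
    (hU : ∀ x ∈ U, ∀ y ∈ U,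
      (QuotientAddGroup.mk x : E ⧸ M) = QuotientAddGroup.mk y → x = y) :
    ∀ x : E, p ^ n • x ∈ U → ∀ y : E, p ^ n • y ∈ U →
      (QuotientAddGroup.mk x : E ⧸ L) = QuotientAddGroup.mk y → x = y := by
  intro x hx y hy hxy
  have hL : -x + y ∈ L := QuotientAddGroup.eq.mp hxy
  have hM : p ^ n • (-x + y) ∈ (M : Set E) := himg ▸ Set.mem_image_of_mem _ hL
  have hpn : p ^ n • x = p ^ n • y := by
    refine hU _ hx _ hy (QuotientAddGroup.eq.mpr ?_)
    rwa [smul_add, smul_neg] at hM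
  have hzero : -x + y = 0 :=
    hinj _ hL _ L.zero_mem (by rw [smul_add, smul_neg, hpn, neg_add_cancel, smul_zero])
  exact neg_add_eq_zero.mp hzero
end

section
/- Let p be a prime. Let L ≤ Π_{n∈ℕ} (ℝ/ℤ) be the inverse limit of the tower ⋯ →[p] ℝ/ℤ →[p] ℝ/ℤ with transition maps multiplication by p, i.e. L = {y : ℕ → ℝ/ℤ : p·y(n+1) = y(n) for all n}, and let φ : ℝ → L be the homomorphism with φ(x)(n) = (x/p^n) mod ℤ. Then φ is an injective group homomorphism, and the quotient group L/φ(ℝ) is isomorphic to ℤ_p/ℤ. (Thus there is an exact sequence 0 → ℝ → lim_{[p]} ℝ/ℤ → ℤ_p/ℤ → 0.) -/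
/-- The inverse limit `L = lim (⋯ →[p] ℝ/ℤ →[p] ℝ/ℤ)` of the tower of circles with transition
maps multiplication by `p`, as a subgroup of `Π n, ℝ/ℤ`. -/
noncomputable def limSub (p : ℕ) : AddSubgroup (ℕ → AddCircle (1 : ℝ)) where
  carrier := {y | ∀ n : ℕ, p • y (n + 1) = y n}
  zero_mem' := fun n => smul_zero p
  add_mem' {a b} ha hb := fun n => by
    simp only [Pi.add_apply, smul_add, ha n, hb n]
  neg_mem' {a} ha := fun n => by
    simp only [Pi.neg_apply, smul_neg, ha n]

theorem nsmul_toAddCircle_intCast (p : ℕ) [NeZero p] (n : ℕ) (a : ℤ) :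
    p • ZMod.toAddCircle (a : ZMod (p ^ (n + 1))) = ZMod.toAddCircle (a : ZMod (p ^ n)) := by
  have hp : (p : ℝ) ≠ 0 := Nat.cast_ne_zero.mpr (NeZero.ne p)
  rw [ZMod.toAddCircle_intCast, ZMod.toAddCircle_intCast, ← AddCircle.coe_nsmul]
  congr 1
  push_cast
  rw [nsmul_eq_mul]
  field_simp
  ring

theorem nsmul_toAddCircle_toZModPow (p : ℕ) [Fact p.Prime] (n : ℕ) (z : ℤ_[p]) :
    p • ZMod.toAddCircle (PadicInt.toZModPow (n + 1) z) =
      ZMod.toAddCircle (PadicInt.toZModPow n z) := by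
  obtain ⟨a, ha⟩ := ZMod.intCast_surjective (PadicInt.toZModPow (n + 1) z)
  rw [← PadicInt.cast_toZModPow n (n + 1) n.le_succ z, ← ha, nsmul_toAddCircle_intCast,
    ZMod.cast_intCast (pow_dvd_pow p n.le_succ)]

/-- The homomorphism `ℝ → limSub p` sending `x` to the sequence `(x / p ^ n mod ℤ)`. -/
noncomputable def realToLimSub (p : ℕ) [NeZero p] : ℝ →+ limSub p where
  toFun x := ⟨fun n => ((x / (p : ℝ) ^ n : ℝ) : AddCircle (1 : ℝ)), fun n => by
    have hp : (p : ℝ) ≠ 0 := Nat.cast_ne_zero.mpr (NeZero.ne p)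
    rw [← AddCircle.coe_nsmul, nsmul_eq_mul]
    congr 1
    field_simp
    ring⟩
  map_zero' := by ext n; simp
  map_add' x y := by ext n; simp [add_div]

theorem realToLimSub_apply (p : ℕ) [NeZero p] (x : ℝ) (n : ℕ) :
    (realToLimSub p x : ℕ → AddCircle (1 : ℝ)) n = ((x / (p : ℝ) ^ n : ℝ) : AddCircle (1 : ℝ)) :=
  rfl

theorem realToLimSub_injective {p : ℕ} [NeZero p] (hp : 1 < p) :
    Function.Injective (realToLimSub p) := by
  refine (injective_iff_map_eq_zero _).mpr fun x hx => ?_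
  obtain ⟨n, hn⟩ := pow_unbounded_of_one_lt |x| (Nat.one_lt_cast.mpr hp)
  have h : ((x / (p : ℝ) ^ n : ℝ) : AddCircle (1 : ℝ)) = 0 := by
    rw [← realToLimSub_apply, hx]
    rfl
  obtain ⟨k, hk⟩ := (AddCircle.coe_eq_zero_iff _).mp h
  have hpos : (0 : ℝ) < (p : ℝ) ^ n := (abs_nonneg x).trans_lt hn
  rw [zsmul_one, eq_div_iff hpos.ne'] at hk
  rw [← hk, abs_mul, abs_of_pos hpos] at hn
  have hk1 : |(k : ℝ)| < 1 := by nlinarith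
  have hk0 : k = 0 := Int.abs_lt_one_iff.mp (by exact_mod_cast hk1)
  simpa [hk0] using hk.symm

/-- The homomorphism `ℤ_[p] → limSub p` sending `z` to the sequence
`((z mod p ^ n) / p ^ n mod ℤ)`. -/
noncomputable def padicIntToLimSub (p : ℕ) [Fact p.Prime] : ℤ_[p] →+ limSub p where
  toFun z := ⟨fun n => ZMod.toAddCircle (PadicInt.toZModPow n z),
    fun n => nsmul_toAddCircle_toZModPow p n z⟩
  map_zero' := by ext n; simp
  map_add' x y := by ext n; simp

theorem padicIntToLimSub_apply (p : ℕ) [Fact p.Prime] (z : ℤ_[p]) (n : ℕ) :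
    (padicIntToLimSub p z : ℕ → AddCircle (1 : ℝ)) n =
      ZMod.toAddCircle (PadicInt.toZModPow n z) :=
  rfl

theorem padicIntToLimSub_intCast (p : ℕ) [Fact p.Prime] (m : ℤ) :
    padicIntToLimSub p m = realToLimSub p m := by
  ext n
  rw [padicIntToLimSub_apply, realToLimSub_apply, map_intCast, ZMod.toAddCircle_intCast,
    Nat.cast_pow]

theorem padicIntToLimSub_injective (p : ℕ) [Fact p.Prime] :
    Function.Injective (padicIntToLimSub p) := fun _ _ h =>
  PadicInt.ext_of_toZModPow.mp fun n => ZMod.toAddCircle_injective _ <|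
    congrFun (congrArg Subtype.val h) n

theorem limSub_pow_nsmul_apply {p : ℕ} (y : limSub p) (n : ℕ) :
    p ^ n • (y : ℕ → AddCircle (1 : ℝ)) n = (y : ℕ → AddCircle (1 : ℝ)) 0 := by
  induction n with
  | zero => simp
  | succ n ih => rw [pow_succ, mul_nsmul', y.2 n, ih]

theorem exists_padicIntToLimSub_eq {p : ℕ} [Fact p.Prime] (y : limSub p)
    (hy : (y : ℕ → AddCircle (1 : ℝ)) 0 = 0) : ∃ z, padicIntToLimSub p z = y := by
  have h (n : ℕ) : ∃ a : ℤ,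
      ZMod.toAddCircle (a : ZMod (p ^ n)) = (y : ℕ → AddCircle (1 : ℝ)) n := by
    obtain ⟨x, hx⟩ := QuotientAddGroup.mk_surjective ((y : ℕ → AddCircle (1 : ℝ)) n)
    have hp : (p : ℝ) ^ n ≠ 0 := pow_ne_zero _ (Nat.cast_ne_zero.mpr (NeZero.ne p))
    have h0 := limSub_pow_nsmul_apply y n
    rw [hy, ← hx] at h0
    obtain ⟨a, ha⟩ := (AddCircle.coe_eq_zero_iff (1 : ℝ) (x := p ^ n • x)).mp h0
    refine ⟨a, ?_⟩
    rw [ZMod.toAddCircle_intCast, ← hx]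
    congr 1
    rw [zsmul_one, nsmul_eq_mul] at ha
    rw [ha]
    push_cast
    field_simp
  choose a ha using h
  have hdvd (n : ℕ) : (p : ℤ) ^ n ∣ a (n + 1) - a n := by
    have h1 := y.2 n
    rw [← ha, ← ha, nsmul_toAddCircle_intCast, ZMod.toAddCircle_inj] at h1
    exact_mod_cast (ZMod.intCast_eq_intCast_iff_dvd_sub _ _ _).mp h1.symm
  refine ⟨PadicInt.ofIntSeq _ (PadicInt.isCauSeq_padicNorm_of_pow_dvd_sub a p hdvd), ?_⟩
  ext n
  rw [padicIntToLimSub_apply, PadicInt.toZModPow_ofIntSeq_of_pow_dvd_sub a p hdvd, ha]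

theorem padicIntToLimSub_mem_range_iff {p : ℕ} [Fact p.Prime] (z : ℤ_[p]) :
    padicIntToLimSub p z ∈ (realToLimSub p).range ↔ z ∈ (Int.castAddHom ℤ_[p]).range := by
  constructor
  · rintro ⟨x, hx⟩
    have h0 : ((x / (p : ℝ) ^ 0 : ℝ) : AddCircle (1 : ℝ)) = 0 := by
      have : Subsingleton (ZMod (p ^ 0)) := by rw [pow_zero]; infer_instance
      rw [← realToLimSub_apply, hx, padicIntToLimSub_apply,
        Subsingleton.elim (PadicInt.toZModPow 0 z) 0, map_zero]
    obtain ⟨m, hm⟩ := (AddCircle.coe_eq_zero_iff _).mp h0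
    rw [zsmul_one, pow_zero, div_one] at hm
    refine ⟨m, padicIntToLimSub_injective p ?_⟩
    rw [Int.coe_castAddHom, padicIntToLimSub_intCast, hm, hx]
  · rintro ⟨m, rfl⟩
    exact ⟨m, (padicIntToLimSub_intCast p m).symm⟩

theorem mk_comp_padicIntToLimSub_surjective (p : ℕ) [Fact p.Prime] :
    Function.Surjective
      ((QuotientAddGroup.mk' (realToLimSub p).range).comp (padicIntToLimSub p)) := by
  intro q
  obtain ⟨y, rfl⟩ := QuotientAddGroup.mk'_surjective _ q
  obtain ⟨x, hx⟩ := QuotientAddGroup.mk_surjective ((y : ℕ → AddCircle (1 : ℝ)) 0)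
  obtain ⟨z, hz⟩ := exists_padicIntToLimSub_eq (y - realToLimSub p x) (by
    rw [AddSubgroup.coe_sub, Pi.sub_apply, realToLimSub_apply, ← hx, pow_zero, div_one]
    exact sub_self _)
  refine ⟨z, ?_⟩
  rw [AddMonoidHom.comp_apply, hz, map_sub, sub_eq_self]
  exact (QuotientAddGroup.eq_zero_iff _).mpr ⟨x, rfl⟩

/-- Let `p` be a prime, `L = lim_{[p]} ℝ/ℤ` the inverse limit of the tower
`⋯ →[p] ℝ/ℤ →[p] ℝ/ℤ`, and `φ : ℝ → L` the homomorphism with `φ(x)(n) = (x/pⁿ) mod ℤ`. Then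
`φ` is an injective group homomorphism and `L/φ(ℝ) ≅ ℤ_p/ℤ`; thus there is an exact sequence
`0 → ℝ → lim_{[p]} ℝ/ℤ → ℤ_p/ℤ → 0`. -/
theorem solenoid_mod_R_iso_Zp_mod_Z (p : ℕ) [Fact p.Prime] :
    ∃ Φ : ℝ →+ limSub p,
      (∀ (x : ℝ) (n : ℕ),
        ((Φ x : ℕ → AddCircle (1 : ℝ)) n) = ((x / (p : ℝ) ^ n : ℝ) : AddCircle (1 : ℝ))) ∧
      Function.Injective Φ ∧
      Nonempty ((limSub p ⧸ Φ.range) ≃+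
        (ℤ_[p] ⧸ (Int.castAddHom ℤ_[p]).range)) := by
  have hker : ((QuotientAddGroup.mk' (realToLimSub p).range).comp (padicIntToLimSub p)).ker =
      (Int.castAddHom ℤ_[p]).range := by
    ext z
    rw [← padicIntToLimSub_mem_range_iff]
    exact QuotientAddGroup.eq_zero_iff _
  exact ⟨realToLimSub p, realToLimSub_apply p,
    realToLimSub_injective (Fact.out : p.Prime).one_lt,
    ⟨(QuotientAddGroup.quotientKerEquivOfSurjective _
      (mk_comp_padicIntToLimSub_surjective p)).symm.trans
        (QuotientAddGroup.quotientAddEquivOfEq hker)⟩⟩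
end

section
/- Let p be a prime and let D : (Π_{n∈ℕ} ℤ) → (Π_{n∈ℕ} ℤ) be the group homomorphism D(b)(n) = b(n) − p·b(n+1). Then the homomorphism Σ : Π_{n∈ℕ} ℤ → ℤ_p/ℤ sending a to the class of the (p-adically convergent) sum Σ_{n≥0} a(n)·p^n is surjective, and its kernel is exactly the range of D. In particular the cokernel of D, which is lim¹ of the tower (ℤ, multiplication by p), is isomorphic to ℤ_p/ℤ. -/
/-- The map `Π n, ℤ → Π n, ℤ`, `b ↦ (n ↦ b n - p * b (n+1))`, whose cokernel is `lim¹` of the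
tower `⋯ →[p] ℤ →[p] ℤ`. -/
def Dmap (p : ℕ) : (ℕ → ℤ) →+ (ℕ → ℤ) where
  toFun b := fun n => b n - p * b (n + 1)
  map_zero' := by funext n; simp
  map_add' a b := by funext n; simp only [Pi.add_apply]; ring

/-- The `p`-adic series with integer coefficients converges. -/
theorem summable_intCast_mul_pow (p : ℕ) [Fact p.Prime] (a : ℕ → ℤ) :
    Summable fun n : ℕ => (a n : ℤ_[p]) * (p : ℤ_[p]) ^ n := by
  have hp : ‖(p : ℤ_[p])‖ < 1 := PadicInt.norm_lt_one_iff_dvd _ |>.2 dvd_rfl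
  refine Summable.of_norm_bounded (summable_geometric_of_lt_one (norm_nonneg _) hp) fun n => ?_
  rw [norm_mul, norm_pow]
  exact mul_le_of_le_one_left (by positivity) (PadicInt.norm_le_one _)

/-- A sequence of remainders with `r n = a n + p * r (n + 1)` computes the sum `Σ a n * p ^ n`. -/
theorem tsum_intCast_mul_pow_eq_of_remainder (p : ℕ) [Fact p.Prime] (a : ℕ → ℤ) (r : ℕ → ℤ_[p])
    (h : ∀ n, r n = a n + p * r (n + 1)) :
    ∑' n : ℕ, (a n : ℤ_[p]) * (p : ℤ_[p]) ^ n = r 0 := by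
  have hp : ‖(p : ℤ_[p])‖ < 1 := PadicInt.norm_lt_one_iff_dvd _ |>.2 dvd_rfl
  have partial_sum (n : ℕ) : ∑ k ∈ Finset.range n, (a k : ℤ_[p]) * (p : ℤ_[p]) ^ k
      = r 0 - (p : ℤ_[p]) ^ n * r n := by
    induction n with
    | zero => simp
    | succ n ih => rw [Finset.sum_range_succ, ih, h n]; ring
  have remainder_tendsto :
      Filter.Tendsto (fun n => (p : ℤ_[p]) ^ n * r n) Filter.atTop (nhds 0) := by
    refine squeeze_zero_norm (fun n => ?_)
      (tendsto_pow_atTop_nhds_zero_of_lt_one (norm_nonneg (p : ℤ_[p])) hp)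
    rw [norm_mul, norm_pow]
    exact mul_le_of_le_one_right (by positivity) (PadicInt.norm_le_one _)
  refine tendsto_nhds_unique (summable_intCast_mul_pow p a).hasSum.tendsto_sum_nat ?_
  simp_rw [partial_sum]
  simpa using remainder_tendsto.const_sub (r 0)

theorem tsum_intCast_mul_pow_eq_add (p : ℕ) [Fact p.Prime] (a : ℕ → ℤ) :
    ∑' n : ℕ, (a n : ℤ_[p]) * (p : ℤ_[p]) ^ n
      = a 0 + p * ∑' n : ℕ, (a (n + 1) : ℤ_[p]) * (p : ℤ_[p]) ^ n := by
  rw [(summable_intCast_mul_pow p a).tsum_eq_zero_add,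
    ← (summable_intCast_mul_pow p fun n => a (n + 1)).tsum_mul_left]
  simp only [pow_zero, mul_one, pow_succ']
  congr 2
  funext n
  ring

/-- Every `p`-adic integer is the sum of a series `Σ a n * p ^ n` with integer coefficients. -/
theorem exists_tsum_intCast_mul_pow_eq (p : ℕ) [Fact p.Prime] (x : ℤ_[p]) :
    ∃ a : ℕ → ℤ, ∑' n : ℕ, (a n : ℤ_[p]) * (p : ℤ_[p]) ^ n = x := by
  have digit (y : ℤ_[p]) : ∃ z : ℤ_[p], y = y.zmodRepr + p * z := by
    obtain ⟨z, hz⟩ := (PadicInt.norm_lt_one_iff_dvd _).1 (PadicInt.norm_sub_zmodRepr_lt_one y)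
    exact ⟨z, by rw [← hz]; ring⟩
  choose next hnext using digit
  refine ⟨fun n => ((next^[n] x).zmodRepr : ℤ),
    tsum_intCast_mul_pow_eq_of_remainder p _ (fun n => next^[n] x) fun n => ?_⟩
  rw [Function.iterate_succ_apply', Int.cast_natCast]
  exact hnext _

/-- If `Σ a n * p ^ n` is an integer, then so is the sum for the shifted sequence. -/
theorem exists_intCast_eq_tsum_shift (p : ℕ) [Fact p.Prime] (a : ℕ → ℤ)
    (h : ∃ m : ℤ, (m : ℤ_[p]) = ∑' n : ℕ, (a n : ℤ_[p]) * (p : ℤ_[p]) ^ n) :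
    ∃ m : ℤ, (m : ℤ_[p]) = ∑' n : ℕ, (a (n + 1) : ℤ_[p]) * (p : ℤ_[p]) ^ n := by
  obtain ⟨m, hm⟩ := h
  rw [tsum_intCast_mul_pow_eq_add, ← sub_eq_iff_eq_add', ← Int.cast_sub] at hm
  obtain ⟨k, hk⟩ : (p : ℤ) ∣ m - a 0 := by
    simpa using (PadicInt.pow_p_dvd_int_iff 1 (m - a 0)).1 (by simpa using Dvd.intro _ hm.symm)
  refine ⟨k, mul_left_cancel₀ (PadicInt.prime_p (p := p)).ne_zero ?_⟩
  rw [← hm, hk]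
  push_cast
  rfl

theorem exists_intCast_eq_tsum_iff_mem_range (p : ℕ) [Fact p.Prime] (a : ℕ → ℤ) :
    (∃ m : ℤ, (m : ℤ_[p]) = ∑' n : ℕ, (a n : ℤ_[p]) * (p : ℤ_[p]) ^ n) ↔
      a ∈ (Dmap p).range := by
  constructor
  · intro h
    have tails (n : ℕ) :
        ∃ m : ℤ, (m : ℤ_[p]) = ∑' k : ℕ, (a (k + n) : ℤ_[p]) * (p : ℤ_[p]) ^ k := by
      induction n with
      | zero => exact h
      | succ n ih =>
        simpa only [add_assoc, add_comm 1 n] using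
          exists_intCast_eq_tsum_shift p (fun k => a (k + n)) ih
    choose b hb using tails
    refine ⟨b, funext fun n => ?_⟩
    have key := tsum_intCast_mul_pow_eq_add p fun k => a (k + n)
    simp only [add_assoc, add_comm 1 n, zero_add] at key
    rw [← hb, ← hb] at key
    have key' : b n = a n + p * b (n + 1) := by exact_mod_cast key
    change b n - p * b (n + 1) = a n
    rw [key', add_sub_cancel_right]
  · rintro ⟨b, rfl⟩
    refine ⟨b 0, (tsum_intCast_mul_pow_eq_of_remainder p _ (fun n => (b n : ℤ_[p]))
      fun n => ?_).symm⟩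
    simp [Dmap]

/-- The homomorphism `a ↦ Σ a n * p ^ n` from integer sequences to `ℤ_p / ℤ`. -/
noncomputable def sumModInt (p : ℕ) [Fact p.Prime] :
    (ℕ → ℤ) →+ ℤ_[p] ⧸ (Int.castAddHom ℤ_[p]).range :=
  (QuotientAddGroup.mk' _).comp
    { toFun := fun a => ∑' n : ℕ, (a n : ℤ_[p]) * (p : ℤ_[p]) ^ n
      map_zero' := by simp
      map_add' := fun a b => by
        rw [← (summable_intCast_mul_pow p a).tsum_add (summable_intCast_mul_pow p b)]
        simp [add_mul] }

theorem sumModInt_surjective (p : ℕ) [Fact p.Prime] : Function.Surjective (sumModInt p) := by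
  intro y
  obtain ⟨x, rfl⟩ := QuotientAddGroup.mk_surjective y
  obtain ⟨a, rfl⟩ := exists_tsum_intCast_mul_pow_eq p x
  exact ⟨a, rfl⟩

theorem ker_sumModInt (p : ℕ) [Fact p.Prime] : (sumModInt p).ker = (Dmap p).range := by
  ext a
  exact (QuotientAddGroup.eq_zero_iff _).trans (exists_intCast_eq_tsum_iff_mem_range p a)

/-- Let `p` be a prime and `D : (Π n, ℤ) → (Π n, ℤ)` the homomorphism
`D(b)(n) = b(n) - p·b(n+1)`. Then `Σ : Π n, ℤ → ℤ_p/ℤ`, sending `a` to the class of the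
`p`-adically convergent sum `Σ_{n≥0} a(n)·pⁿ`, is surjective with kernel exactly the range of
`D`. In particular the cokernel of `D`, which is `lim¹` of the tower `(ℤ, ·p)`, is isomorphic
to `ℤ_p/ℤ`. -/
theorem lim1_of_p_tower_of_Z (p : ℕ) [Fact p.Prime] :
    (Function.Surjective fun a : ℕ → ℤ =>
      (QuotientAddGroup.mk (∑' n : ℕ, (a n : ℤ_[p]) * (p : ℤ_[p]) ^ n) :
        ℤ_[p] ⧸ (Int.castAddHom ℤ_[p]).range)) ∧
    (∀ a : ℕ → ℤ,
      (QuotientAddGroup.mk (∑' n : ℕ, (a n : ℤ_[p]) * (p : ℤ_[p]) ^ n) :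
        ℤ_[p] ⧸ (Int.castAddHom ℤ_[p]).range) = 0 ↔ a ∈ (Dmap p).range) ∧
    Nonempty (((ℕ → ℤ) ⧸ (Dmap p).range) ≃+
      (ℤ_[p] ⧸ (Int.castAddHom ℤ_[p]).range)) := by
  refine ⟨sumModInt_surjective p, fun a => ?_, ⟨?_⟩⟩
  · rw [← ker_sumModInt p]
    rfl
  · exact (QuotientAddGroup.quotientAddEquivOfEq (ker_sumModInt p).symm).trans
      (QuotientAddGroup.quotientKerEquivOfSurjective _ (sumModInt_surjective p))
end
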